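/- Let E be a centrally orthocomplete pseudo-effect algebra and K ⊆ E a type-determining set. Then: (i) K ∩ γK = K ∩ Γ(E) ⊆ γK ⊆ Γ(E); (ii) there exists c ∈ Γ(E) such that γK = Γ(E)[0,c]; (iii) there exists d ∈ Γ(E) such that K ∩ γK = Γ(E)[0,d]. -/

import Mathlib

namespace PEApaper

/-- The bare data of a partial-addition structure: a partial binary operation
(encoded via `Option`) together with constants `0` and `1`. -/
structure PartialStruct (E : Type) where
  padd : E → E → Option E
  zero : E
  one : E

namespace PartialStruct

variable {E : Type}

/-- `a ≤ b` iff `a + c = b` for some `c`. -/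
def le (P : PartialStruct E) (a b : E) : Prop := ∃ c, P.padd a c = some b

/-- `m` is the greatest lower bound (meet `a ∧ b`) of `a` and `b`. -/
def IsMeet (P : PartialStruct E) (a b m : E) : Prop :=
  P.le m a ∧ P.le m b ∧ ∀ x, P.le x a → P.le x b → P.le x m

/-- `j` is the least upper bound (join `a ∨ b`) of `a` and `b`. -/
def IsJoin (P : PartialStruct E) (a b j : E) : Prop :=
  P.le a j ∧ P.le b j ∧ ∀ x, P.le a x → P.le b x → P.le j x

/-- `s` is the supremum of the set `S`. -/
def IsSup (P : PartialStruct E) (S : Set E) (s : E) : Prop :=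
  (∀ x ∈ S, P.le x s) ∧ ∀ u, (∀ x ∈ S, P.le x u) → P.le s u

/-- Left-associated partial sum of a list, continuing from `acc`. -/
def IsSumFrom (P : PartialStruct E) : E → List E → E → Prop
  | acc, [], s => s = acc
  | acc, a :: l, s => ∃ t, P.padd acc a = some t ∧ IsSumFrom P t l s

/-- `s` is the (left-associated) orthosum `e₁ + e₂ + ⋯ + eₙ` of the list. -/
def IsSumList (P : PartialStruct E) (l : List E) (s : E) : Prop :=
  match l with
  | [] => s = P.zero
  | a :: t => IsSumFrom P a t s

/-- `c` is a central element: there is a PEA-isomorphism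
`f : E → E[0,c] × E[0,c∼]` with `f c = (c,0)` such that `f x = (x₁,x₂)`
implies `x = x₁ + x₂`.  The isomorphism onto the product of the two
interval pseudo-effect algebras is spelled out explicitly. -/
def IsCentral (P : PartialStruct E) (c : E) : Prop :=
  ∃ cs, P.padd c cs = some P.one ∧
    ∃ f : E → E × E,
      (∀ x, P.le (f x).1 c ∧ P.le (f x).2 cs) ∧
      Function.Injective f ∧
      (∀ y : E × E, P.le y.1 c → P.le y.2 cs → ∃ x, f x = y) ∧
      f c = (c, P.zero) ∧
      f P.one = (c, cs) ∧
      (∀ x, P.padd (f x).1 (f x).2 = some x) ∧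
      (∀ a b ab, P.padd a b = some ab →
        P.padd (f a).1 (f b).1 = some (f ab).1 ∧
        P.padd (f a).2 (f b).2 = some (f ab).2) ∧
      (∀ a b s t, P.padd (f a).1 (f b).1 = some s → P.le s c →
        P.padd (f a).2 (f b).2 = some t → P.le t cs →
        ∃ ab, P.padd a b = some ab)

/-- The center `Γ(E)`. -/
def center (P : PartialStruct E) : Set E := {c | P.IsCentral c}

/-- The central interval `Γ(E)[0,c] = Γ(E) ∩ E[0,c]`. -/
def centerIntervalSet (P : PartialStruct E) (c : E) : Set E :=
  {x | P.IsCentral x ∧ P.le x c}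

/-- A Γ-orthogonal family: one dominated elementwise by a pairwise
disjoint family of central elements. -/
def GammaOrthogonal (P : PartialStruct E) {I : Type} (e : I → E) : Prop :=
  ∃ c : I → E, (∀ i, P.IsCentral (c i)) ∧
    (∀ i j, i ≠ j → P.IsMeet (c i) (c j) P.zero) ∧
    ∀ i, P.le (e i) (c i)

/-- Centrally orthocomplete: every Γ-orthogonal family has a supremum. -/
def IsCOPEA (P : PartialStruct E) : Prop :=
  ∀ (I : Type) (e : I → E), P.GammaOrthogonal e → ∃ s, P.IsSup (Set.range e) s

/-- `c` is the central cover of `e`: the smallest central element above `e`. -/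
def IsCentralCover (P : PartialStruct E) (c e : E) : Prop :=
  P.IsCentral c ∧ P.le e c ∧ ∀ d, P.IsCentral d → P.le e d → P.le c d

/-- `[Q]`: the set of all suprema of Γ-orthogonal families of elements of `Q`. -/
def bra (P : PartialStruct E) (Q : Set E) : Set E :=
  {s | ∃ (I : Type) (e : I → E), (∀ i, e i ∈ Q) ∧ P.GammaOrthogonal e ∧
    P.IsSup (Set.range e) s}

/-- `Q^γ = {q ∧ c : q ∈ Q, c ∈ Γ(E)}`. -/
def gammaClosure (P : PartialStruct E) (Q : Set E) : Set E :=
  {m | ∃ q ∈ Q, ∃ c, P.IsCentral c ∧ P.IsMeet q c m}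

/-- `Q↓ = ⋃_{q ∈ Q} E[0,q]`. -/
def downSet (P : PartialStruct E) (Q : Set E) : Set E :=
  {e | ∃ q ∈ Q, P.le e q}

/-- `Q' = {e ∈ E : q ∧ e = 0 for all q ∈ Q}`. -/
def commutant (P : PartialStruct E) (Q : Set E) : Set E :=
  {e | ∀ q ∈ Q, P.IsMeet q e P.zero}

/-- A type-determining (TD) set: `K = [K] = K^γ`. -/
def IsTD (P : PartialStruct E) (K : Set E) : Prop :=
  P.bra K = K ∧ P.gammaClosure K = K

/-- A strongly type-determining (STD) set: `K = [K] = K↓`. -/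
def IsSTD (P : PartialStruct E) (K : Set E) : Prop :=
  P.bra K = K ∧ P.downSet K = K

/-- `c` is the type-cover of `K` (w.r.t. the central cover map `γ`):
the unique central element with `γK = Γ(E)[0,c]`. -/
def IsTypeCover (P : PartialStruct E) (γ : E → E) (K : Set E) (c : E) : Prop :=
  P.IsCentral c ∧ γ '' K = P.centerIntervalSet c

/-- An atom: a nonzero element with no proper nonzero subelement. -/
def IsAtom' (P : PartialStruct E) (a : E) : Prop :=
  a ≠ P.zero ∧ ∀ x, P.le x a → x = P.zero ∨ x = a

end PartialStruct

/-- A PEA-isomorphism between two partial-addition structures: a bijective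
morphism whose inverse is a morphism. -/
structure IsPEAIso {A B : Type} (P : PartialStruct A) (Q : PartialStruct B)
    (f : A → B) : Prop where
  bijective : Function.Bijective f
  map_one : f P.one = Q.one
  map_add : ∀ a b ab, P.padd a b = some ab → Q.padd (f a) (f b) = some (f ab)
  rev_add : ∀ a b s, Q.padd (f a) (f b) = some s → ∃ ab, P.padd a b = some ab

open scoped Classical in
/-- The (coordinatewise) product of a family of partial structures. -/
noncomputable def prodStruct {I : Type} {A : I → Type}
    (Ps : ∀ i, PartialStruct (A i)) : PartialStruct (∀ i, A i) where
  padd a b :=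
    if h : ∀ i, ∃ s, (Ps i).padd (a i) (b i) = some s
    then some fun i => Classical.choose (h i)
    else none
  zero := fun i => (Ps i).zero
  one := fun i => (Ps i).one

/-- A pseudo-effect algebra. -/
structure PEA (E : Type) extends PartialStruct E where
  assoc_def : ∀ a b c : E,
    (∃ ab, padd a b = some ab ∧ ∃ x, padd ab c = some x) ↔
    (∃ bc, padd b c = some bc ∧ ∃ y, padd a bc = some y)
  assoc_eq : ∀ a b c ab bc x y, padd a b = some ab → padd ab c = some x →
    padd b c = some bc → padd a bc = some y → x = y
  exu_right : ∀ a : E, ∃! d, padd a d = some one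
  exu_left : ∀ a : E, ∃! e, padd e a = some one
  shift : ∀ a b ab, padd a b = some ab →
    (∃ d, padd d a = some ab) ∧ (∃ e, padd b e = some ab)
  one_add : ∀ a x, padd one a = some x → a = zero
  add_one : ∀ a x, padd a one = some x → a = zero

namespace PEA

variable {E : Type} (P : PEA E)

/-- Shorthand for the underlying partial structure. -/
abbrev ps : PartialStruct E := P.toPartialStruct

theorem one_add_zero : P.padd P.one P.zero = some P.one := by
  obtain ⟨d, hd, -⟩ := P.exu_right P.one
  have h := P.one_add d P.one hd
  rwa [h] at hd

theorem zero_add_one : P.padd P.zero P.one = some P.one := by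
  obtain ⟨e, he, -⟩ := P.exu_left P.one
  have h := P.add_one e P.one he
  rwa [h] at he

theorem padd_zero (a : E) : P.padd a P.zero = some a := by
  obtain ⟨e, he, -⟩ := P.exu_left a
  have h1 : ∃ ab, P.padd e a = some ab ∧ ∃ x, P.padd ab P.zero = some x :=
    ⟨P.one, he, P.one, P.one_add_zero⟩
  obtain ⟨t, ht, y, hy⟩ := (P.assoc_def e a P.zero).mp h1
  have hxy : P.one = y :=
    P.assoc_eq e a P.zero P.one t P.one y he P.one_add_zero ht hy
  obtain ⟨d, hd, hu⟩ := P.exu_right e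
  have hta : t = a := by
    have h2 : t = d := hu t (by rw [← hxy] at hy; exact hy)
    have h3 : a = d := hu a he
    rw [h2, h3]
  rwa [hta] at ht

theorem zero_padd (a : E) : P.padd P.zero a = some a := by
  obtain ⟨d, hd, -⟩ := P.exu_right a
  have h1 : ∃ bc, P.padd a d = some bc ∧ ∃ y, P.padd P.zero bc = some y :=
    ⟨P.one, hd, P.one, P.zero_add_one⟩
  obtain ⟨t, ht, y, hy⟩ := (P.assoc_def P.zero a d).mpr h1
  have hxy : y = P.one :=
    P.assoc_eq P.zero a d t P.one y P.one ht hy hd P.zero_add_one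
  obtain ⟨e, he, hu⟩ := P.exu_left d
  have hta : t = a := by
    have h2 : t = e := hu t (by rw [hxy] at hy; exact hy)
    have h3 : a = e := hu a hd
    rw [h2, h3]
  rwa [hta] at ht

theorem zero_le (a : E) : P.ps.le P.zero a := ⟨a, P.zero_padd a⟩

theorem le_refl (a : E) : P.ps.le a a := ⟨P.zero, P.padd_zero a⟩

open scoped Classical in
/-- The interval pseudo-effect algebra `E[0,p]` as a partial structure on
the subtype `{x // x ≤ p}`; the sum is defined iff it is defined in `E`
and lies below `p`, and the unit is `p`. -/
noncomputable def intervalStruct (p : E) :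
    PartialStruct {x : E // P.ps.le x p} where
  padd a b := (P.padd a.1 b.1).bind fun s =>
    if h : P.ps.le s p then some ⟨s, h⟩ else none
  zero := ⟨P.zero, P.zero_le p⟩
  one := ⟨p, P.le_refl p⟩

end PEA

/-- The order relation of a complete Boolean algebra structure, made explicit. -/
def cbaLe {X : Type} (inst : CompleteBooleanAlgebra X) (a b : X) : Prop :=
  @LE.le X (by letI := inst; exact inferInstance) a b

end PEApaper

namespace PEApaper

namespace PEA

variable {E : Type} {P : PEA E}

section Order

theorem padd_assoc {a b c ab x : E} (h₁ : P.padd a b = some ab) (h₂ : P.padd ab c = some x) :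
    ∃ bc, P.padd b c = some bc ∧ P.padd a bc = some x := by
  obtain ⟨bc, hbc, y, hy⟩ := (P.assoc_def a b c).mp ⟨ab, h₁, x, h₂⟩
  exact ⟨bc, hbc, by rw [hy, P.assoc_eq a b c ab bc x y h₁ h₂ hbc hy]⟩

theorem padd_assoc' {a b c bc x : E} (h₁ : P.padd b c = some bc) (h₂ : P.padd a bc = some x) :
    ∃ ab, P.padd a b = some ab ∧ P.padd ab c = some x := by
  obtain ⟨ab, hab, y, hy⟩ := (P.assoc_def a b c).mpr ⟨bc, h₁, x, h₂⟩
  exact ⟨ab, hab, by rw [hy, P.assoc_eq a b c ab bc y x hab hy h₁ h₂]⟩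

theorem padd_left_cancel {a b c s : E} (hb : P.padd a b = some s) (hc : P.padd a c = some s) :
    b = c := by
  obtain ⟨e, he, -⟩ := P.exu_left s
  obtain ⟨u, hu, hu'⟩ := padd_assoc' hb he
  obtain ⟨v, hv, hv'⟩ := padd_assoc' hc he
  obtain rfl : u = v := Option.some.inj (hu.symm.trans hv)
  exact (P.exu_right u).unique hu' hv'

theorem eq_zero_of_padd_self {a b : E} (h : P.padd a b = some a) : b = P.zero :=
  padd_left_cancel h (P.padd_zero a)

theorem left_eq_zero_of_padd {a b : E} (h : P.padd a b = some P.zero) : a = P.zero := by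
  obtain ⟨u, hu, -⟩ := padd_assoc' h P.one_add_zero
  exact P.one_add a u hu

theorem le_trans {a b c : E} (hab : P.ps.le a b) (hbc : P.ps.le b c) : P.ps.le a c := by
  obtain ⟨x, hx⟩ := hab
  obtain ⟨y, hy⟩ := hbc
  obtain ⟨z, -, hz⟩ := padd_assoc hx hy
  exact ⟨z, hz⟩

theorem le_antisymm {a b : E} (hab : P.ps.le a b) (hba : P.ps.le b a) : a = b := by
  obtain ⟨x, hx⟩ := hab
  obtain ⟨y, hy⟩ := hba
  obtain ⟨z, hz, hz'⟩ := padd_assoc hx hy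
  rw [eq_zero_of_padd_self hz'] at hz
  rw [left_eq_zero_of_padd hz, P.padd_zero] at hx
  exact Option.some.inj hx

theorem eq_zero_of_le_zero {a : E} (h : P.ps.le a P.zero) : a = P.zero :=
  le_antisymm h (P.zero_le a)

theorem le_one (a : E) : P.ps.le a P.one := (P.exu_right a).exists

theorem le_of_padd_right {a b s : E} (h : P.padd a b = some s) : P.ps.le b s :=
  (P.shift a b s h).2

end Order

/-- A decomposition of `E` as the direct product of the intervals below `f 1` and `g 1`,
given by the two coordinate maps. -/
structure IsSplitting (P : PEA E) (f g : E → E) : Prop where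
  padd_fst : ∀ {a b s}, P.padd a b = some s → P.padd (f a) (f b) = some (f s)
  padd_snd : ∀ {a b s}, P.padd a b = some s → P.padd (g a) (g b) = some (g s)
  exists_padd : ∀ {a b s t}, P.padd (f a) (f b) = some s → P.padd (g a) (g b) = some t →
    ∃ u, P.padd a b = some u
  fst_padd_snd : ∀ x, P.padd (f x) (g x) = some x
  snd_fst_one : g (f P.one) = P.zero

namespace IsSplitting

variable {f g f' g' : E → E}

theorem fst_mono (h : P.IsSplitting f g) {a b : E} (hab : P.ps.le a b) :
    P.ps.le (f a) (f b) := by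
  obtain ⟨x, hx⟩ := hab
  exact ⟨_, h.padd_fst hx⟩

theorem snd_mono (h : P.IsSplitting f g) {a b : E} (hab : P.ps.le a b) :
    P.ps.le (g a) (g b) := by
  obtain ⟨x, hx⟩ := hab
  exact ⟨_, h.padd_snd hx⟩

theorem fst_le (h : P.IsSplitting f g) (x : E) : P.ps.le (f x) x := ⟨_, h.fst_padd_snd x⟩

theorem fst_le_one (h : P.IsSplitting f g) (x : E) : P.ps.le (f x) (f P.one) :=
  h.fst_mono (le_one x)

theorem eq_of_eq (h : P.IsSplitting f g) {x y : E} (hf : f x = f y) (hg : g x = g y) :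
    x = y := by
  have hx := h.fst_padd_snd x
  rw [hf, hg, h.fst_padd_snd y] at hx
  exact (Option.some.inj hx).symm

theorem padd_of_padd (h : P.IsSplitting f g) {a b s : E}
    (h₁ : P.padd (f a) (f b) = some (f s)) (h₂ : P.padd (g a) (g b) = some (g s)) :
    P.padd a b = some s := by
  obtain ⟨u, hu⟩ := h.exists_padd h₁ h₂
  have hf := Option.some.inj ((h.padd_fst hu).symm.trans h₁)
  have hg := Option.some.inj ((h.padd_snd hu).symm.trans h₂)
  rw [hu, h.eq_of_eq hf hg]

theorem snd_eq_zero (h : P.IsSplitting f g) {x : E} (hx : P.ps.le x (f P.one)) :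
    g x = P.zero :=
  eq_zero_of_le_zero (h.snd_fst_one ▸ h.snd_mono hx)

theorem fst_eq_self (h : P.IsSplitting f g) {x : E} (hx : P.ps.le x (f P.one)) : f x = x := by
  have hs := h.fst_padd_snd x
  rw [h.snd_eq_zero hx, P.padd_zero] at hs
  exact Option.some.inj hs

theorem fst_eq_zero (h : P.IsSplitting f g) {x : E} (hx : P.ps.le x (g P.one)) :
    f x = P.zero := by
  have hs := h.padd_fst (h.fst_padd_snd P.one)
  rw [h.fst_eq_self (P.le_refl _)] at hs
  exact eq_zero_of_le_zero (eq_zero_of_padd_self hs ▸ h.fst_mono hx)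

theorem snd_eq_self (h : P.IsSplitting f g) {x : E} (hx : P.ps.le x (g P.one)) : g x = x := by
  have hs := h.fst_padd_snd x
  rw [h.fst_eq_zero hx, P.zero_padd] at hs
  exact Option.some.inj hs

theorem snd_le (h : P.IsSplitting f g) (x : E) : P.ps.le (g x) x :=
  le_of_padd_right (h.fst_padd_snd x)

theorem snd_le_one (h : P.IsSplitting f g) (x : E) : P.ps.le (g x) (g P.one) :=
  h.snd_mono (le_one x)

theorem le_fst (h : P.IsSplitting f g) {x y : E} (hy : P.ps.le y x)
    (hy' : P.ps.le y (f P.one)) : P.ps.le y (f x) :=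
  h.fst_eq_self hy' ▸ h.fst_mono hy

theorem isMeet_fst (h : P.IsSplitting f g) (x : E) : P.ps.IsMeet x (f P.one) (f x) :=
  ⟨h.fst_le x, h.fst_le_one x, fun _ => h.le_fst⟩

theorem fst_fst (h : P.IsSplitting f g) (x : E) : f (f x) = f x := h.fst_eq_self (h.fst_le_one x)

theorem snd_snd (h : P.IsSplitting f g) (x : E) : g (g x) = g x := h.snd_eq_self (h.snd_le_one x)

theorem fst_snd (h : P.IsSplitting f g) (x : E) : f (g x) = P.zero :=
  h.fst_eq_zero (h.snd_le_one x)

theorem snd_fst (h : P.IsSplitting f g) (x : E) : g (f x) = P.zero :=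
  h.snd_eq_zero (h.fst_le_one x)

theorem symm (h : P.IsSplitting f g) : P.IsSplitting g f where
  padd_fst := h.padd_snd
  padd_snd := h.padd_fst
  exists_padd hs ht := h.exists_padd ht hs
  fst_padd_snd x := by
    have h₁ : P.padd (f (g x)) (f (f x)) = some (f x) := by
      rw [h.fst_snd, h.fst_fst, P.zero_padd]
    have h₂ : P.padd (g (g x)) (g (f x)) = some (g x) := by
      rw [h.snd_snd, h.snd_fst, P.padd_zero]
    exact h.padd_of_padd h₁ h₂
  snd_fst_one := h.fst_snd _

theorem exists_eq (h : P.IsSplitting f g) {u v : E} (hu : P.ps.le u (f P.one))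
    (hv : P.ps.le v (g P.one)) : ∃ x, f x = u ∧ g x = v := by
  have h₁ : P.padd (f u) (f v) = some u := by
    rw [h.fst_eq_self hu, h.fst_eq_zero hv, P.padd_zero]
  have h₂ : P.padd (g u) (g v) = some v := by
    rw [h.snd_eq_self hv, h.snd_eq_zero hu, P.zero_padd]
  obtain ⟨x, hx⟩ := h.exists_padd h₁ h₂
  exact ⟨x, Option.some.inj ((h.padd_fst hx).symm.trans h₁),
    Option.some.inj ((h.padd_snd hx).symm.trans h₂)⟩

theorem isCentral (h : P.IsSplitting f g) : P.ps.IsCentral (f P.one) := by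
  refine ⟨g P.one, h.fst_padd_snd _, fun x => (f x, g x),
    fun x => ⟨h.fst_le_one x, h.snd_le_one x⟩, ?_, ?_, ?_, rfl, h.fst_padd_snd,
    fun a b s hs => ⟨h.padd_fst hs, h.padd_snd hs⟩,
    fun a b s t hs _ ht _ => h.exists_padd hs ht⟩
  · intro x y hxy
    exact h.eq_of_eq (congrArg Prod.fst hxy) (congrArg Prod.snd hxy)
  · rintro ⟨u, v⟩ hu hv
    obtain ⟨x, hx, hx'⟩ := h.exists_eq hu hv
    exact ⟨x, Prod.ext hx hx'⟩
  · exact Prod.ext (h.fst_fst _) h.snd_fst_one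

theorem fst_comm (h : P.IsSplitting f g) (h' : P.IsSplitting f' g') (x : E) :
    f (f' x) = f' (f x) := by
  have key : ∀ {f g f' g' : E → E}, P.IsSplitting f g → P.IsSplitting f' g' →
      P.ps.le (f (f' x)) (f' (f x)) := fun h h' =>
    h'.le_fst (h.fst_mono (h'.fst_le x)) (le_trans (h.fst_le _) (h'.fst_le_one x))
  exact le_antisymm (key h h') (key h' h)

theorem exists_comp (h : P.IsSplitting f g) (h' : P.IsSplitting f' g') :
    ∃ k, P.IsSplitting (fun x => f (f' x)) k := by
  choose k hkf hkg using fun x => h.exists_eq (h.fst_le_one (g' x)) (h.snd_le_one x)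
  refine ⟨k, fun hs => h.padd_fst (h'.padd_fst hs), ?_, ?_, ?_, ?_⟩
  · intro a b s hs
    have h₁ := h.padd_fst (h'.padd_snd hs)
    have h₂ := h.padd_snd hs
    rw [← hkf a, ← hkf b, ← hkf s] at h₁
    rw [← hkg a, ← hkg b, ← hkg s] at h₂
    exact h.padd_of_padd h₁ h₂
  · intro a b s t hs ht
    have h₁ := h.padd_fst ht
    have h₂ := h.padd_snd ht
    rw [hkf, hkf, h.fst_comm h'.symm, h.fst_comm h'.symm] at h₁
    rw [hkg, hkg] at h₂
    rw [h.fst_comm h', h.fst_comm h'] at hs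
    obtain ⟨u, hu⟩ := h'.exists_padd hs h₁
    exact h.exists_padd hu h₂
  · intro x
    have h₁ : P.padd (f (f (f' x))) (f (k x)) = some (f x) := by
      rw [h.fst_fst, hkf]
      exact h.padd_fst (h'.fst_padd_snd x)
    have h₂ : P.padd (g (f (f' x))) (g (k x)) = some (g x) := by
      rw [h.snd_fst, hkg, P.zero_padd]
    exact h.padd_of_padd h₁ h₂
  · have hf : f (k (f (f' P.one))) = P.zero := by
      rw [hkf, h.fst_comm h', h'.snd_fst]
      exact eq_zero_of_le_zero (h.fst_le _)
    have hg : g (k (f (f' P.one))) = P.zero := by rw [hkg, h.snd_fst]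
    have hs := h.fst_padd_snd (k (f (f' P.one)))
    rw [hf, hg, P.padd_zero] at hs
    exact (Option.some.inj hs).symm

theorem le_fst_one (h : P.IsSplitting f g) {x : E} (hx : g x = P.zero) :
    P.ps.le x (f P.one) := by
  have hs := h.fst_padd_snd x
  rw [hx, P.padd_zero] at hs
  exact Option.some.inj hs ▸ h.fst_le_one x

end IsSplitting

theorem exists_isSplitting {c : E} (hc : P.ps.IsCentral c) :
    ∃ f g, P.IsSplitting f g ∧ f P.one = c := by
  obtain ⟨cs, hc1, φ, hle, -, -, hφc, hφ1, hsum, hadd, hex⟩ := hc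
  have hsnd : ∀ {x}, P.ps.le x c → (φ x).2 = P.zero := by
    rintro x ⟨y, hy⟩
    have h := (hadd _ _ _ hy).2
    rw [hφc] at h
    exact left_eq_zero_of_padd h
  have hfst : ∀ {x}, P.ps.le x c → (φ x).1 = x := by
    intro x hx
    have h := hsum x
    rw [hsnd hx] at h
    exact Option.some.inj ((P.padd_zero _).symm.trans h)
  have hfst_cs : (φ cs).1 = P.zero := by
    have h := (hadd _ _ _ hc1).1
    rw [hφc, hφ1] at h
    exact eq_zero_of_padd_self h
  have hfst' : ∀ {x}, P.ps.le x cs → (φ x).1 = P.zero := by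
    rintro x ⟨y, hy⟩
    have h := (hadd _ _ _ hy).1
    rw [hfst_cs] at h
    exact left_eq_zero_of_padd h
  have hsum_le : ∀ {a b s}, P.ps.le a c → P.ps.le b c → P.padd a b = some s →
      P.ps.le s c := by
    intro a b s ha hb hs
    have h := (hadd _ _ _ hs).2
    rw [hsnd ha, hsnd hb, P.padd_zero] at h
    have h' := hsum s
    rw [← Option.some.inj h, P.padd_zero] at h'
    exact Option.some.inj h' ▸ (hle s).1
  have hsum_le' : ∀ {a b s}, P.ps.le a cs → P.ps.le b cs → P.padd a b = some s →
      P.ps.le s cs := by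
    intro a b s ha hb hs
    have h := (hadd _ _ _ hs).1
    rw [hfst' ha, hfst' hb, P.padd_zero] at h
    have h' := hsum s
    rw [← Option.some.inj h, P.zero_padd] at h'
    exact Option.some.inj h' ▸ (hle s).2
  refine ⟨fun x => (φ x).1, fun x => (φ x).2, ⟨fun hs => (hadd _ _ _ hs).1,
    fun hs => (hadd _ _ _ hs).2, fun {a b s t} hs ht => hex a b s t hs
      (hsum_le (hle a).1 (hle b).1 hs) ht (hsum_le' (hle a).2 (hle b).2 ht), hsum, ?_⟩, ?_⟩
  · simp only [hφ1, hφc]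
  · simp only [hφ1]

theorem IsSplitting.isCentral_fst {f g : E → E} (h : P.IsSplitting f g) {d : E}
    (hd : P.ps.IsCentral d) : P.ps.IsCentral (f d) := by
  obtain ⟨f', g', h', rfl⟩ := exists_isSplitting hd
  obtain ⟨k, hk⟩ := h.exists_comp h'
  exact hk.isCentral

section CentralCover

variable {γ : E → E} {f g : E → E}

theorem IsSplitting.fst_cover_eq_zero (hγ : ∀ e, P.ps.IsCentralCover (γ e) e)
    (h : P.IsSplitting f g) {k : E} (hk : f k = P.zero) : f (γ k) = P.zero :=
  h.fst_eq_zero ((hγ k).2.2 _ h.symm.isCentral (h.symm.le_fst_one hk))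

theorem cover_eq_self (hγ : ∀ e, P.ps.IsCentralCover (γ e) e) {c : E}
    (hc : P.ps.IsCentral c) : γ c = c :=
  le_antisymm ((hγ c).2.2 c hc (P.le_refl c)) (hγ c).2.1

theorem cover_mono (hγ : ∀ e, P.ps.IsCentralCover (γ e) e) {a b : E} (hab : P.ps.le a b) :
    P.ps.le (γ a) (γ b) :=
  (hγ a).2.2 _ (hγ b).1 (le_trans hab (hγ b).2.1)

/-- If `d` is central and `d ≤ γ k`, then `γ (k ∧ d) = d`. -/
theorem IsSplitting.cover_fst (hγ : ∀ e, P.ps.IsCentralCover (γ e) e)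
    (h : P.IsSplitting f g) {k : E} (hk : P.ps.le (f P.one) (γ k)) :
    γ (f k) = f P.one := by
  refine le_antisymm ((hγ _).2.2 _ h.isCentral (h.fst_le_one k)) ?_
  obtain ⟨u, v, huv, hu⟩ := exists_isSplitting (hγ (f k)).1
  obtain ⟨p, q, hpq, hp⟩ := exists_isSplitting (huv.symm.isCentral_fst h.isCentral)
  have hpk : p k = P.zero := by
    have hle : P.ps.le (p k) (v (f P.one)) := hp ▸ hpq.fst_le_one k
    have hle₁ : P.ps.le (p k) (f k) :=
      h.le_fst (hpq.fst_le k) (le_trans hle (huv.snd_le _))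
    have hle₂ : P.ps.le (p k) (u P.one) := hu ▸ le_trans hle₁ (hγ _).2.1
    rw [← huv.fst_eq_self hle₂]
    exact huv.fst_eq_zero (le_trans hle (huv.snd_le_one _))
  have hv : v (f P.one) = P.zero := by
    have hle : P.ps.le (p P.one) (γ k) := hp ▸ le_trans (huv.snd_le _) hk
    rw [← hp]
    exact eq_zero_of_le_zero (hpq.fst_cover_eq_zero hγ hpk ▸ hpq.le_fst hle (P.le_refl _))
  exact hu ▸ huv.le_fst_one hv

/-- The supremum of any set of central elements is central. -/
theorem isCentral_of_isSup (hγ : ∀ e, P.ps.IsCentralCover (γ e) e) {S : Set E} {d : E}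
    (hS : ∀ s ∈ S, P.ps.IsCentral s) (hd : P.ps.IsSup S d) : P.ps.IsCentral d := by
  obtain ⟨x, hx⟩ := (hγ d).2.1
  obtain ⟨u, v, huv, hu⟩ := exists_isSplitting (hγ x).1
  have hdv : P.ps.le d (v P.one) := by
    refine hd.2 _ fun s hs => ?_
    obtain ⟨f, g, h, rfl⟩ := exists_isSplitting (hS s hs)
    have hfx : f x = P.zero := by
      have hsum := h.padd_fst hx
      have hfd : f d = f P.one := le_antisymm (h.fst_le_one d) (h.le_fst (hd.1 _ hs) (P.le_refl _))
      have hfγ : f (γ d) = f P.one :=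
        le_antisymm (h.fst_le_one _) (hfd ▸ h.fst_mono (hγ d).2.1)
      rw [hfd, hfγ] at hsum
      exact eq_zero_of_padd_self hsum
    have hfu : f (u P.one) = P.zero := hu ▸ h.fst_cover_eq_zero hγ hfx
    refine huv.symm.le_fst_one (eq_zero_of_le_zero (hfu ▸ ?_))
    exact h.le_fst (huv.fst_le_one _) (huv.fst_le _)
  have hγv : P.ps.le (γ d) (v P.one) := (hγ d).2.2 _ huv.symm.isCentral hdv
  have hx0 : x = P.zero := by
    rw [← huv.fst_eq_self (hu ▸ (hγ x).2.1 : P.ps.le x (u P.one))]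
    exact huv.fst_eq_zero (le_trans (le_of_padd_right hx) hγv)
  rw [hx0, P.padd_zero] at hx
  exact Option.some.inj hx ▸ (hγ d).1

/-- A set closed under meets with central elements has a `Γ`-orthogonal supremum whose
central cover dominates the whole set. -/
theorem exists_mem_bra_forall_le_cover (hco : P.ps.IsCOPEA)
    (hγ : ∀ e, P.ps.IsCentralCover (γ e) e) {A : Set E} (hA : P.ps.gammaClosure A ⊆ A) :
    ∃ S ⊆ A, ∃ s ∈ P.ps.bra A, P.ps.IsSup S s ∧ ∀ a ∈ A, P.ps.le a (γ s) := by
  let r : E → E → Prop := fun a b => P.ps.IsMeet (γ a) (γ b) P.zero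
  obtain ⟨S, hS⟩ := zorn_subset {S : Set E | S ⊆ A ∧ S.Pairwise r} fun C hC hchain => by
    refine ⟨⋃₀ C, ⟨Set.sUnion_subset fun S hS => (hC hS).1, ?_⟩,
      fun S hS => Set.subset_sUnion_of_mem hS⟩
    exact (Set.pairwise_sUnion hchain.directedOn).2 fun S hS => (hC hS).2
  have horth : P.ps.GammaOrthogonal (fun i : S => (i : E)) :=
    ⟨fun i => γ i, fun i => (hγ i).1,
      fun i j hij => hS.prop.2 i.2 j.2 fun h => hij (Subtype.ext h), fun i => (hγ i).2.1⟩
  obtain ⟨s, hs⟩ := hco S _ horth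
  refine ⟨S, hS.prop.1, s, ⟨S, _, fun i => hS.prop.1 i.2, horth, hs⟩, by
    simpa using hs, fun a ha => ?_⟩
  rw [Subtype.range_coe] at hs
  obtain ⟨f, g, h, hf⟩ := exists_isSplitting (hγ s).1
  have hga : P.ps.le (γ (g a)) (g P.one) :=
    (hγ _).2.2 _ h.symm.isCentral (h.snd_le_one a)
  have hmem : g a ∈ A := hA ⟨a, ha, _, h.symm.isCentral, h.symm.isMeet_fst a⟩
  have hSf : ∀ b ∈ S, P.ps.le (γ b) (f P.one) := fun b hb => hf ▸ cover_mono hγ (hs.1 b hb)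
  have hzero : ∀ {x}, P.ps.le x (f P.one) → P.ps.le x (g P.one) → P.ps.le x P.zero := by
    intro x hx hx'
    rw [← h.fst_eq_self hx, h.fst_eq_zero hx']
    exact P.le_refl _
  have hins : insert (g a) S ∈ {S : Set E | S ⊆ A ∧ S.Pairwise r} := by
    refine ⟨Set.insert_subset hmem hS.prop.1, hS.prop.2.insert fun b hb _ => ⟨?_, ?_⟩⟩
    · exact ⟨P.zero_le _, P.zero_le _, fun x hx hx' =>
        hzero (le_trans hx' (hSf b hb)) (le_trans hx hga)⟩
    · exact ⟨P.zero_le _, P.zero_le _, fun x hx hx' =>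
        hzero (le_trans hx (hSf b hb)) (le_trans hx' hga)⟩
  have hgS : g a ∈ S := hS.le_of_ge hins (Set.subset_insert _ _) (Set.mem_insert _ _)
  have hg0 : g a = P.zero := eq_zero_of_le_zero
    (hzero (le_trans (hγ _).2.1 (hSf _ hgS)) (h.snd_le_one a))
  exact hf ▸ h.le_fst_one hg0

end CentralCover

end PEA

end PEApaper

open PEApaper PEApaper.PartialStruct in
/-- Theorem 5.3: in a COPEA, for a TD set `K`:
(i) `K ∩ γK = K ∩ Γ(E) ⊆ γK ⊆ Γ(E)`;
(ii) `γK = Γ(E)[0,c]` for some `c ∈ Γ(E)`;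
(iii) `K ∩ γK = Γ(E)[0,d]` for some `d ∈ Γ(E)`. -/
theorem stmt13 {E : Type} (P : PEA E) (hco : P.ps.IsCOPEA)
    (γ : E → E) (hγ : ∀ e, P.ps.IsCentralCover (γ e) e)
    (K : Set E) (hK : P.ps.IsTD K) :
    (K ∩ (γ '' K) = K ∩ P.ps.center ∧
      K ∩ P.ps.center ⊆ γ '' K ∧ γ '' K ⊆ P.ps.center) ∧
    (∃ c, P.ps.IsCentral c ∧ γ '' K = P.ps.centerIntervalSet c) ∧
    (∃ d, P.ps.IsCentral d ∧ K ∩ (γ '' K) = P.ps.centerIntervalSet d) := by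
  have hKγ : ∀ {k c}, k ∈ K → P.ps.IsCentral c → ∀ {m}, P.ps.IsMeet k c m → m ∈ K :=
    fun hk hc _ hm => hK.2 ▸ ⟨_, hk, _, hc, hm⟩
  have hsub : γ '' K ⊆ P.ps.center := by
    rintro _ ⟨k, -, rfl⟩
    exact (hγ k).1
  have hsub' : K ∩ P.ps.center ⊆ γ '' K := fun k hk => ⟨k, hk.1, PEA.cover_eq_self hγ hk.2⟩
  have heq : K ∩ (γ '' K) = K ∩ P.ps.center :=
    Set.Subset.antisymm (Set.inter_subset_inter_right K hsub) fun k hk => ⟨hk.1, hsub' hk⟩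
  refine ⟨⟨heq, hsub', hsub⟩, ?_, ?_⟩
  · obtain ⟨-, -, s, hs, -, hle⟩ := PEA.exists_mem_bra_forall_le_cover hco hγ hK.2.subset
    refine ⟨γ s, (hγ s).1, Set.Subset.antisymm ?_ ?_⟩
    · rintro _ ⟨k, hk, rfl⟩
      exact ⟨(hγ k).1, (hγ k).2.2 _ (hγ s).1 (hle k hk)⟩
    · rintro d ⟨hd, hds⟩
      obtain ⟨f, g, h, rfl⟩ := PEA.exists_isSplitting hd
      exact ⟨f s, hKγ (hK.1 ▸ hs) hd (h.isMeet_fst s), h.cover_fst hγ hds⟩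
  · have hA : P.ps.gammaClosure (K ∩ P.ps.center) ⊆ K ∩ P.ps.center := by
      rintro m ⟨k, ⟨hk, hk'⟩, c, hc, hm⟩
      refine ⟨hKγ hk hc hm, ?_⟩
      obtain ⟨f, g, h, rfl⟩ := PEA.exists_isSplitting hc
      have hmf : m = f k := PEA.le_antisymm (h.le_fst hm.1 hm.2.1)
        (hm.2.2 _ (h.fst_le k) (h.fst_le_one k))
      exact hmf ▸ h.isCentral_fst hk'
    obtain ⟨S, hSA, d, ⟨I, e, he, horth, hsup⟩, hd, hle⟩ :=
      PEA.exists_mem_bra_forall_le_cover hco hγ hA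
    have hdK : d ∈ K := hK.1 ▸ ⟨I, e, fun i => (he i).1, horth, hsup⟩
    have hdc : P.ps.IsCentral d := PEA.isCentral_of_isSup hγ (fun s hs => (hSA hs).2) hd
    rw [PEA.cover_eq_self hγ hdc] at hle
    refine ⟨d, hdc, heq.trans (Set.Subset.antisymm (fun k hk => ⟨hk.2, hle k hk⟩) ?_)⟩
    rintro c ⟨hc, hcd⟩
    exact ⟨hKγ hdK hc ⟨hcd, P.le_refl c, fun _ _ hx => hx⟩, hc⟩
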